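/- Let E ⊆ ℝ^d be an open bounded set and s ∈ (0,1). Define the fractional perimeter Per_s(E) = (1/|B^{d-1}|) ∫_E ∫_{E^c} |y-x|^{-d-s} dy dx, where |B^{d-1}| is the (d-1)-dimensional Lebesgue measure of the unit ball in ℝ^{d-1}. Define P_s(E) as the supremum, over all antisymmetric C¹ functions f : ℝ^d × ℝ^d → ℝ with |f| ≤ 1, of c_{d,s} ∫_E div^{(s)} f(x) dx, where div^{(s)} f(x) = 2 ∫_{ℝ^d} f(x,y) (2ds(1-s)/H^{d-1}(S^{d-1})) |y-x|^{-d-s} dy and c_{d,s} = H^{d-1}(S^{d-1})/(4ds|B^{d-1}|). Then P_s(E) = (1-s) Per_s(E). -/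

import Mathlib

open MeasureTheory

/-- Surface measure of the unit sphere `S^{d-1}` in `ℝ^d`. -/
noncomputable def sphereArea (d : ℕ) : ℝ :=
  d * Real.pi ^ ((d : ℝ) / 2) / Real.Gamma ((d : ℝ) / 2 + 1)

/-- Volume of the unit ball in `ℝ^{d-1}`. -/
noncomputable def ballVol (m : ℕ) : ℝ :=
  (volume (Metric.ball (0 : EuclideanSpace ℝ (Fin m)) 1)).toReal


section FracPer

variable {d : ℕ}

lemma fp_radial_integrable (hd : 0 < d) {s C : ℝ} (hs0 : 0 < s) (hs1 : s < 1) (hC : 0 ≤ C) :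
    Integrable (fun z : EuclideanSpace ℝ (Fin d) =>
      min (C * ‖z‖) 1 * ‖z‖ ^ (-(d : ℝ) - s)) volume := by
  have : Nonempty (Fin d) := ⟨⟨0, hd⟩⟩
  rw [integrable_fun_norm_addHaar volume (f := fun t : ℝ => min (C * t) 1 * t ^ (-(d : ℝ) - s))]
  rw [finrank_euclideanSpace_fin]
  have hmeas : Measurable (fun y : ℝ => y ^ (d - 1) • (min (C * y) 1 * y ^ (-(d : ℝ) - s))) := by
    fun_prop
  have hpow : ∀ y : ℝ, 0 < y → y ^ (d - 1) * y ^ (-(d : ℝ) - s) = y ^ (-1 - s) := by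
    intro y hy
    rw [← Real.rpow_natCast, ← Real.rpow_add hy, Nat.cast_sub hd]
    congr 1
    push_cast
    ring
  rw [← Set.Ioc_union_Ioi_eq_Ioi (zero_le_one (α := ℝ))]
  refine IntegrableOn.union ?_ ?_
  · have h1 : IntegrableOn (fun y : ℝ => C * y ^ (-s)) (Set.Ioc 0 1) := by
      have := intervalIntegral.intervalIntegrable_rpow' (a := 0) (b := 1) (r := -s) (by linarith)
      rw [intervalIntegrable_iff_integrableOn_Ioc_of_le zero_le_one] at this
      exact this.const_mul C
    refine Integrable.mono' h1 hmeas.aestronglyMeasurable ?_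
    refine (ae_restrict_iff' measurableSet_Ioc).2 (Filter.Eventually.of_forall ?_)
    intro y hy
    have hy0 : 0 < y := hy.1
    have hmin : 0 ≤ min (C * y) 1 := le_min (by positivity) zero_le_one
    have hp := hpow y hy0
    have hq : y * y ^ (-1 - s) = y ^ (-s) := by
      nth_rewrite 1 [← Real.rpow_one y]
      rw [← Real.rpow_add hy0]
      congr 1
      ring
    rw [Real.norm_of_nonneg (by simp only [smul_eq_mul]; positivity), smul_eq_mul]
    calc y ^ (d - 1) * (min (C * y) 1 * y ^ (-(d : ℝ) - s))
        = min (C * y) 1 * y ^ (-1 - s) := by rw [← hp]; ring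
      _ ≤ (C * y) * y ^ (-1 - s) := by
          gcongr
          exact min_le_left _ _
      _ = C * y ^ (-s) := by rw [← hq]; ring
  · have h1 : IntegrableOn (fun y : ℝ => y ^ (-1 - s)) (Set.Ioi 1) :=
      (integrableOn_Ioi_rpow_iff zero_lt_one).2 (by linarith)
    refine Integrable.mono' h1 hmeas.aestronglyMeasurable ?_
    refine (ae_restrict_iff' measurableSet_Ioi).2 (Filter.Eventually.of_forall ?_)
    intro y hy
    have hy0 : 0 < y := lt_trans zero_lt_one hy
    have hmin : 0 ≤ min (C * y) 1 := le_min (by positivity) zero_le_one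
    have hp := hpow y hy0
    rw [Real.norm_of_nonneg (by simp only [smul_eq_mul]; positivity), smul_eq_mul]
    calc y ^ (d - 1) * (min (C * y) 1 * y ^ (-(d : ℝ) - s))
        = min (C * y) 1 * y ^ (-1 - s) := by rw [← hp]; ring
      _ ≤ 1 * y ^ (-1 - s) := by
          gcongr
          exact min_le_right _ _
      _ = y ^ (-1 - s) := one_mul _

lemma fp_lipschitz_bound {E : Set (EuclideanSpace ℝ (Fin d))} (hEbdd : Bornology.IsBounded E)
    {f : EuclideanSpace ℝ (Fin d) → EuclideanSpace ℝ (Fin d) → ℝ}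
    (hanti : ∀ x y, f x y = - f y x)
    (hC1 : ContDiff ℝ 1 (fun p : EuclideanSpace ℝ (Fin d) × EuclideanSpace ℝ (Fin d) =>
          f p.1 p.2))
    (hle : ∀ x y, |f x y| ≤ 1) :
    ∃ C : ℝ, 0 ≤ C ∧ ∀ x ∈ E, ∀ y, |f x y| ≤ min (C * ‖y - x‖) 1 := by
  obtain ⟨R, hR⟩ := hEbdd.subset_closedBall 0
  set B : Set (EuclideanSpace ℝ (Fin d)) := Metric.closedBall 0 (R + 1) with hB
  have hBc : IsCompact B := isCompact_closedBall _ _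
  have hBv : Convex ℝ B := convex_closedBall _ _
  obtain ⟨K, hK⟩ := (hC1.contDiffOn (s := B ×ˢ B)).exists_lipschitzOnWith one_ne_zero
    (hBv.prod hBv) (hBc.prod hBc)
  refine ⟨max K 1, by positivity, fun x hx y => le_min ?_ (hle x y)⟩
  by_cases hxy : ‖y - x‖ ≤ 1
  · have hxn : ‖x‖ ≤ R := by simpa using hR hx
    have hxB : x ∈ B := by
      simp only [hB, Metric.mem_closedBall, dist_zero_right]; linarith
    have hyB : y ∈ B := by
      simp only [hB, Metric.mem_closedBall, dist_zero_right]
      calc ‖y‖ = ‖x + (y - x)‖ := by congr 1; abel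
        _ ≤ ‖x‖ + ‖y - x‖ := norm_add_le _ _
        _ ≤ R + 1 := by linarith
    have h0 : f x x = 0 := by linarith [hanti x x]
    have h := hK.dist_le_mul (x, y) ⟨hxB, hyB⟩ (x, x) ⟨hxB, hxB⟩
    simp only [Real.dist_eq, h0, sub_zero, Prod.dist_eq, dist_self] at h
    rw [max_eq_right dist_nonneg, dist_eq_norm] at h
    refine h.trans ?_
    gcongr
    exact le_max_left _ _
  · push Not at hxy
    have : (1:ℝ) ≤ max (K : ℝ) 1 := le_max_right _ _
    have h1 := hle x y
    nlinarith

lemma fp_integrable (hd : 0 < d) {E : Set (EuclideanSpace ℝ (Fin d))}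
    (hEbdd : Bornology.IsBounded E) (hEm : MeasurableSet E)
    {s : ℝ} (hs0 : 0 < s) (hs1 : s < 1)
    {f : EuclideanSpace ℝ (Fin d) → EuclideanSpace ℝ (Fin d) → ℝ}
    (hanti : ∀ x y, f x y = - f y x)
    (hC1 : ContDiff ℝ 1 (fun p : EuclideanSpace ℝ (Fin d) × EuclideanSpace ℝ (Fin d) =>
          f p.1 p.2))
    (hle : ∀ x y, |f x y| ≤ 1) :
    Integrable (fun p : EuclideanSpace ℝ (Fin d) × EuclideanSpace ℝ (Fin d) =>
      f p.1 p.2 * ‖p.2 - p.1‖ ^ (-(d : ℝ) - s)) ((volume.restrict E).prod volume) := by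
  obtain ⟨C, hC0, hC⟩ := fp_lipschitz_bound hEbdd hanti hC1 hle
  have hfin : IsFiniteMeasure (volume.restrict E) :=
    ⟨by rw [Measure.restrict_apply_univ]; exact hEbdd.measure_lt_top⟩
  have hrad := fp_radial_integrable hd hs0 hs1 hC0
  have h2 := hrad.comp_snd (volume.restrict E)
  have hmp := measurePreserving_prod_neg_add (volume.restrict E)
    (volume : Measure (EuclideanSpace ℝ (Fin d)))
  have h3 := hmp.integrable_comp_of_integrable h2
  refine Integrable.mono' h3 ?_ ?_
  · refine Measurable.aestronglyMeasurable ?_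
    exact hC1.continuous.measurable.mul
      (((measurable_snd.sub measurable_fst).norm).pow_const _)
  · have : ∀ᵐ p ∂((volume.restrict E).prod
        (volume : Measure (EuclideanSpace ℝ (Fin d)))), p.1 ∈ E :=
      Measure.quasiMeasurePreserving_fst.ae (ae_restrict_mem hEm)
    filter_upwards [this] with p hp
    simp only [Function.comp, neg_add_eq_sub]
    rw [norm_mul, Real.norm_eq_abs, Real.norm_of_nonneg (by positivity)]
    gcongr
    exact hC _ hp _

lemma fp_fubini (hd : 0 < d) {E : Set (EuclideanSpace ℝ (Fin d))}
    (hEbdd : Bornology.IsBounded E) (hEm : MeasurableSet E)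
    {s : ℝ} (hs0 : 0 < s) (hs1 : s < 1)
    {f : EuclideanSpace ℝ (Fin d) → EuclideanSpace ℝ (Fin d) → ℝ}
    (hanti : ∀ x y, f x y = - f y x)
    (hC1 : ContDiff ℝ 1 (fun p : EuclideanSpace ℝ (Fin d) × EuclideanSpace ℝ (Fin d) =>
          f p.1 p.2))
    (hle : ∀ x y, |f x y| ≤ 1) :
    (∀ᵐ x ∂(volume.restrict E),
        IntegrableOn (fun y => f x y * ‖y - x‖ ^ (-(d : ℝ) - s)) Eᶜ) ∧
    IntegrableOn (fun x => ∫ y in Eᶜ, f x y * ‖y - x‖ ^ (-(d : ℝ) - s)) E ∧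
    ∫ x in E, ∫ y, f x y * ‖y - x‖ ^ (-(d : ℝ) - s) =
      ∫ x in E, ∫ y in Eᶜ, f x y * ‖y - x‖ ^ (-(d : ℝ) - s) := by
  have hI := fp_integrable hd hEbdd hEm hs0 hs1 hanti hC1 hle
  have hmono : ∀ S : Set (EuclideanSpace ℝ (Fin d)),
      (volume.restrict E).prod (volume.restrict S) ≤ (volume.restrict E).prod volume :=
    fun S => Measure.prod_mono le_rfl Measure.restrict_le_self
  have hIE := hI.mono_measure (hmono E)
  have hIc := hI.mono_measure (hmono Eᶜ)
  refine ⟨hIc.prod_right_ae, hIc.integral_prod_left, ?_⟩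
  have hzero : ∫ x in E, ∫ y in E, f x y * ‖y - x‖ ^ (-(d : ℝ) - s) = 0 := by
    have h1 := integral_integral_swap (μ := volume.restrict E) (ν := volume.restrict E)
      (f := fun x y => f x y * ‖y - x‖ ^ (-(d : ℝ) - s)) hIE
    have h2 : ∫ y in E, ∫ x in E, f x y * ‖y - x‖ ^ (-(d : ℝ) - s) =
        - ∫ y in E, ∫ x in E, f y x * ‖x - y‖ ^ (-(d : ℝ) - s) := by
      rw [← integral_neg]
      congr 1
      ext y
      rw [← integral_neg]
      congr 1
      ext x
      rw [hanti x y, norm_sub_rev]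
      ring
    linarith
  have hsplit : ∫ x in E, ∫ y, f x y * ‖y - x‖ ^ (-(d : ℝ) - s) =
      ∫ x in E, ((∫ y in E, f x y * ‖y - x‖ ^ (-(d : ℝ) - s)) +
        ∫ y in Eᶜ, f x y * ‖y - x‖ ^ (-(d : ℝ) - s)) := by
    refine integral_congr_ae ?_
    filter_upwards [hI.prod_right_ae] with x hx
    exact (integral_add_compl hEm hx).symm
  rw [hsplit, integral_add hIE.integral_prod_left hIc.integral_prod_left, hzero, zero_add]

end FracPer

/-- Equivalence of the divergence-based fractional perimeter with `(1-s) Per_s(E)`. -/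
theorem fractional_perimeter_equivalence
    {d : ℕ} (hd : 0 < d) (E : Set (EuclideanSpace ℝ (Fin d)))
    (hEopen : IsOpen E) (hEbdd : Bornology.IsBounded E)
    (s : ℝ) (hs : s ∈ Set.Ioo (0:ℝ) 1) :
    sSup {v : ℝ | ∃ f : EuclideanSpace ℝ (Fin d) → EuclideanSpace ℝ (Fin d) → ℝ,
        (∀ x y, f x y = - f y x) ∧
        ContDiff ℝ 1 (fun p : EuclideanSpace ℝ (Fin d) × EuclideanSpace ℝ (Fin d) =>
          f p.1 p.2) ∧
        (∀ x y, |f x y| ≤ 1) ∧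
        v = sphereArea d / (4 * d * s * ballVol (d - 1)) *
          ∫ x in E, (2 * ∫ y, f x y *
            (2 * d * s * (1 - s) / sphereArea d * ‖y - x‖ ^ (-(d : ℝ) - s)))} =
      (1 - s) * ((1 / ballVol (d - 1)) *
        ∫ x in E, ∫ y in Eᶜ, ‖y - x‖ ^ (-(d : ℝ) - s)) := by
  obtain ⟨hs0, hs1⟩ := hs
  have hEm : MeasurableSet E := hEopen.measurableSet
  have hdR : (0:ℝ) < d := by exact_mod_cast hd
  have hbv : 0 < ballVol (d - 1) := by
    unfold ballVol
    exact ENNReal.toReal_pos (Metric.measure_ball_pos volume _ one_pos).ne'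
      measure_ball_lt_top.ne
  have hsa : 0 < sphereArea d := by
    unfold sphereArea
    have : 0 < Real.Gamma ((d : ℝ) / 2 + 1) := Real.Gamma_pos_of_pos (by positivity)
    positivity
  have h1s : 0 < 1 - s := by linarith
  set c : ℝ := (1 - s) / ballVol (d - 1) with hc
  have hcpos : 0 < c := by positivity
  set g : EuclideanSpace ℝ (Fin d) → ℝ := fun x => ∫ y in Eᶜ, ‖y - x‖ ^ (-(d : ℝ) - s) with hg
  have hg0 : ∀ x, 0 ≤ g x := fun x => integral_nonneg fun y => by positivity
  -- constants
  have hval : ∀ f : EuclideanSpace ℝ (Fin d) → EuclideanSpace ℝ (Fin d) → ℝ,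
      (∀ x y, f x y = - f y x) →
      ContDiff ℝ 1 (fun p : EuclideanSpace ℝ (Fin d) × EuclideanSpace ℝ (Fin d) =>
          f p.1 p.2) → (∀ x y, |f x y| ≤ 1) →
      sphereArea d / (4 * d * s * ballVol (d - 1)) *
          ∫ x in E, (2 * ∫ y, f x y *
            (2 * d * s * (1 - s) / sphereArea d * ‖y - x‖ ^ (-(d : ℝ) - s))) =
        c * ∫ x in E, ∫ y in Eᶜ, f x y * ‖y - x‖ ^ (-(d : ℝ) - s) := by
    intro f h1 h2 h3
    rw [← (fp_fubini hd hEbdd hEm hs0 hs1 h1 h2 h3).2.2]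
    have : ∀ x y, f x y * (2 * d * s * (1 - s) / sphereArea d * ‖y - x‖ ^ (-(d : ℝ) - s)) =
        (2 * d * s * (1 - s) / sphereArea d) * (f x y * ‖y - x‖ ^ (-(d : ℝ) - s)) := by
      intro x y; ring
    simp_rw [this, integral_const_mul]
    rw [hc]
    field_simp
    ring
  -- cutoffs
  obtain ⟨φ, hφs, hφC, hφr⟩ := hEopen.exists_contDiff_support_eq (n := 1)
  have hφ0 : ∀ x, 0 ≤ φ x := fun x => (hφr ⟨x, rfl⟩).1
  have hφE : ∀ x ∈ E, 0 < φ x := fun x hx =>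
    lt_of_le_of_ne (hφ0 x) (Ne.symm (by rw [← hφs] at hx; exact hx))
  have hφc : ∀ x, x ∉ E → φ x = 0 := fun x hx => by
    rw [← hφs] at hx; simpa using hx
  set χ : ℕ → EuclideanSpace ℝ (Fin d) → ℝ := fun n x => 1 - Real.exp (-(n * φ x)) with hχ
  have hχ0 : ∀ n x, 0 ≤ χ n x := fun n x => by
    have : Real.exp (-(n * φ x)) ≤ 1 := Real.exp_le_one_iff.2 (by
      have := hφ0 x
      have : 0 ≤ (n:ℝ) * φ x := by positivity
      linarith)
    simp only [hχ]; linarith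
  have hχ1 : ∀ n x, χ n x ≤ 1 := fun n x => by
    have := Real.exp_pos (-(n * φ x))
    simp only [hχ]; linarith
  have hχc : ∀ n x, x ∉ E → χ n x = 0 := fun n x hx => by simp [hχ, hφc x hx]
  have hχlim : ∀ x ∈ E, Filter.Tendsto (fun n => χ n x) Filter.atTop (nhds 1) := by
    intro x hx
    have h1 : Filter.Tendsto (fun n : ℕ => (n:ℝ) * φ x) Filter.atTop Filter.atTop :=
      tendsto_natCast_atTop_atTop.atTop_mul_const (hφE x hx)
    have h2 := (Real.tendsto_exp_neg_atTop_nhds_zero.comp h1).const_sub 1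
    simpa [hχ, Function.comp_def] using h2
  have hA1 : ∀ n, ∀ x y, χ n x - χ n y = -(χ n y - χ n x) := fun n x y => by ring
  have hA2 : ∀ n, ContDiff ℝ 1 (fun p : EuclideanSpace ℝ (Fin d) × EuclideanSpace ℝ (Fin d) =>
      χ n p.1 - χ n p.2) := by
    intro n
    have hφC' : ContDiff ℝ 1 φ := by exact_mod_cast hφC
    have : ContDiff ℝ 1 (χ n) := contDiff_const.sub (contDiff_const.mul hφC').neg.exp
    exact (this.comp contDiff_fst).sub (this.comp contDiff_snd)
  have hA3 : ∀ n, ∀ x y, |χ n x - χ n y| ≤ 1 := fun n x y => by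
    rw [abs_le]
    constructor <;> linarith [hχ0 n x, hχ0 n y, hχ1 n x, hχ1 n y]
  have hχe : ∀ n x, ∀ y ∈ Eᶜ, (χ n x - χ n y) * ‖y - x‖ ^ (-(d : ℝ) - s) =
      χ n x * ‖y - x‖ ^ (-(d : ℝ) - s) := fun n x y hy => by rw [hχc n y hy, sub_zero]
  have hχg : ∀ n x, ∫ y in Eᶜ, (χ n x - χ n y) * ‖y - x‖ ^ (-(d : ℝ) - s) = χ n x * g x := by
    intro n x
    rw [setIntegral_congr_fun hEm.compl (hχe n x), integral_const_mul]
  have hF := fun n => fp_fubini hd hEbdd hEm hs0 hs1 (hA1 n) (hA2 n) (hA3 n)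
  have hχgI : ∀ n, IntegrableOn (fun x => χ n x * g x) E := fun n => by
    have := (hF n).2.1
    simpa only [hχg] using this
  have hKint : ∀ᵐ x ∂(volume.restrict E),
      IntegrableOn (fun y => ‖y - x‖ ^ (-(d : ℝ) - s)) Eᶜ := by
    filter_upwards [(hF 1).1, ae_restrict_mem hEm] with x hx hxE
    have h1 := (integrableOn_congr_fun (hχe 1 x) hEm.compl).1 hx
    have hpos : χ 1 x ≠ 0 := by
      have : Real.exp (-(φ x)) < 1 := Real.exp_lt_one_iff.2 (by linarith [hφE x hxE])
      simp only [hχ, Nat.cast_one, one_mul]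
      linarith
    have h2 := h1.const_mul (χ 1 x)⁻¹
    refine h2.congr (Filter.Eventually.of_forall fun y => ?_)
    simp only
    rw [← mul_assoc, inv_mul_cancel₀ hpos, one_mul]
  have hlimg : ∀ᵐ x ∂(volume.restrict E),
      Filter.Tendsto (fun n => χ n x * g x) Filter.atTop (nhds (g x)) := by
    filter_upwards [ae_restrict_mem hEm] with x hx
    simpa using (hχlim x hx).mul_const (g x)
  have hgm : AEStronglyMeasurable g (volume.restrict E) :=
    aestronglyMeasurable_of_tendsto_ae Filter.atTop
      (fun n => (hχgI n).aestronglyMeasurable) hlimg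
  -- rewrite the set
  set V : Set ℝ := {v : ℝ | ∃ f : EuclideanSpace ℝ (Fin d) → EuclideanSpace ℝ (Fin d) → ℝ,
        (∀ x y, f x y = - f y x) ∧
        ContDiff ℝ 1 (fun p : EuclideanSpace ℝ (Fin d) × EuclideanSpace ℝ (Fin d) =>
          f p.1 p.2) ∧
        (∀ x y, |f x y| ≤ 1) ∧
        v = sphereArea d / (4 * d * s * ballVol (d - 1)) *
          ∫ x in E, (2 * ∫ y, f x y *
            (2 * d * s * (1 - s) / sphereArea d * ‖y - x‖ ^ (-(d : ℝ) - s)))} with hV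
  have hmem : ∀ n, c * ∫ x in E, χ n x * g x ∈ V := fun n =>
    ⟨fun x y => χ n x - χ n y, hA1 n, hA2 n, hA3 n, by
      rw [hval _ (hA1 n) (hA2 n) (hA3 n)]
      simp only [hχg]⟩
  have hRHS : (1 - s) * ((1 / ballVol (d - 1)) * ∫ x in E, g x) = c * ∫ x in E, g x := by
    rw [hc]; ring
  rw [hRHS]
  by_cases hgI : IntegrableOn g E
  · refine IsLUB.csSup_eq ⟨?_, ?_⟩ ⟨_, hmem 0⟩
    · rintro v ⟨f, h1, h2, h3, rfl⟩
      rw [hval f h1 h2 h3]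
      obtain ⟨i1, i2, -⟩ := fp_fubini hd hEbdd hEm hs0 hs1 h1 h2 h3
      refine mul_le_mul_of_nonneg_left ?_ hcpos.le
      refine integral_mono_ae i2 hgI ?_
      filter_upwards [i1, hKint] with x hx1 hx2
      refine integral_mono hx1 hx2 fun y => ?_
      have : 0 ≤ ‖y - x‖ ^ (-(d : ℝ) - s) := by positivity
      have := (abs_le.1 (h3 x y)).2
      simp only
      nlinarith
    · intro b hb
      have hlim : Filter.Tendsto (fun n => ∫ x in E, χ n x * g x) Filter.atTop
          (nhds (∫ x in E, g x)) := by
        refine tendsto_integral_of_dominated_convergence g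
          (fun n => (hχgI n).aestronglyMeasurable) hgI (fun n => ?_) hlimg
        refine Filter.Eventually.of_forall fun x => ?_
        rw [Real.norm_of_nonneg (mul_nonneg (hχ0 n x) (hg0 x))]
        exact mul_le_of_le_one_left (hg0 x) (hχ1 n x)
      exact le_of_tendsto' (hlim.const_mul c) fun n => hb (hmem n)
  · rw [integral_undef hgI, mul_zero]
    refine Real.sSup_of_not_bddAbove ?_
    rintro ⟨M, hM⟩
    apply hgI
    refine ⟨hgm, ?_⟩
    rw [hasFiniteIntegral_iff_ofReal (Filter.Eventually.of_forall hg0)]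
    have hb : ∀ n, ∫⁻ x in E, ENNReal.ofReal (χ n x * g x) ≤ ENNReal.ofReal (M / c) := by
      intro n
      rw [← ofReal_integral_eq_lintegral_ofReal (hχgI n)
        (Filter.Eventually.of_forall fun x => mul_nonneg (hχ0 n x) (hg0 x))]
      refine ENNReal.ofReal_le_ofReal ?_
      rw [le_div_iff₀ hcpos, mul_comm]
      exact hM (hmem n)
    have hfatou : ∫⁻ x in E, ENNReal.ofReal (g x) ≤
        Filter.liminf (fun n => ∫⁻ x in E, ENNReal.ofReal (χ n x * g x)) Filter.atTop := by
      calc ∫⁻ x in E, ENNReal.ofReal (g x)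
          = ∫⁻ x in E, Filter.liminf (fun n => ENNReal.ofReal (χ n x * g x)) Filter.atTop := by
            refine lintegral_congr_ae ?_
            filter_upwards [hlimg] with x hx
            exact ((ENNReal.tendsto_ofReal hx).liminf_eq).symm
        _ ≤ _ := lintegral_liminf_le' fun n =>
            (hχgI n).aestronglyMeasurable.aemeasurable.ennreal_ofReal
    refine lt_of_le_of_lt hfatou (lt_of_le_of_lt ?_ (ENNReal.ofReal_lt_top (r := M / c)))
    refine (Filter.liminf_le_liminf (Filter.Eventually.of_forall hb)).trans ?_
    simp
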